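/- arXiv:1804.03644 — 3 statements merged into one kernel-verified Lean document; each statement's English description precedes it below -/
import Mathlib

section
/- For all a, b ∈ (−1, ∞) and every ρ ∈ [−1, 1]: E_{g₁∼_ρ g₂}[sgn(g₁)|g₁|^a · sgn(g₂)|g₂|^b] = γ_{a+1}^{a+1} · γ_{b+1}^{b+1} · Σ_{k≥0} ( ((1−a)/2)_k · ((1−b)/2)_k / ((3/2)_k · k!) ) · ρ^{2k+1}; equivalently, the expectation equals γ_{a+1}^{a+1} γ_{b+1}^{b+1} · ρ · ₂F₁((1−a)/2, (1−b)/2; 3/2; ρ²). -/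
noncomputable section

open MeasureTheory ProbabilityTheory Real Set

/-- The `r`-th Gaussian norm: `γ_r = (∫ |x|^r (2π)^{-1/2} e^{-x²/2} dx)^{1/r}`. -/
def gaussNorm (r : ℝ) : ℝ :=
  (∫ x : ℝ, |x| ^ r * ((Real.sqrt (2 * Real.pi))⁻¹ * Real.exp (-x ^ 2 / 2))) ^ (1 / r)

/-- Expectation of `Φ(g₁, g₂)` over a pair of `ρ`-correlated standard Gaussians:
`∫∫ Φ(ρs + √(1−ρ²)t, s) dγ(s) dγ(t)`. -/
def corrExp (ρ : ℝ) (Φ : ℝ → ℝ → ℝ) : ℝ :=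
  ∫ t, (∫ s, Φ (ρ * s + Real.sqrt (1 - ρ ^ 2) * t) s ∂(gaussianReal 0 1)) ∂(gaussianReal 0 1)

/-- The rising factorial `(x)_k = x (x+1) ⋯ (x+k−1)`. -/
def risingFac (x : ℝ) : ℕ → ℝ
  | 0 => 1
  | k + 1 => risingFac x k * (x + k)

/-- hypergeometric coefficient -/
def hgc (a b c : ℝ) (k : ℕ) : ℝ :=
  risingFac a k * risingFac b k / (risingFac c k * (Nat.factorial k))

lemma rf_pos {x : ℝ} (hx : 0 < x) (k : ℕ) : 0 < risingFac x k := by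
  induction k with
  | zero => simp [risingFac]
  | succ k ih => rw [risingFac]; positivity

lemma hgc_zero (a b c : ℝ) : hgc a b c 0 = 1 := by simp [hgc, risingFac]

lemma hgc_rec (a b : ℝ) {c : ℝ} (hc : 0 < c) (k : ℕ) :
    (k + 1) * (c + k) * hgc a b c (k + 1) = (a + k) * (b + k) * hgc a b c k := by
  have h1 := (rf_pos hc k).ne'
  have h2 : c + k ≠ 0 := by positivity
  have h3 : ((Nat.factorial k : ℕ) : ℝ) ≠ 0 := by positivity
  simp only [hgc, risingFac, Nat.factorial_succ]
  push_cast
  field_simp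

open PowerSeries in
lemma euler_ps (a b : ℝ) {c : ℝ} (hc : 0 < c) :
    PowerSeries.mk (fun k => risingFac (c - a - b) k / (Nat.factorial k)) *
      PowerSeries.mk (hgc a b c) = PowerSeries.mk (hgc (c - a) (c - b) c) := by
  set P : PowerSeries ℝ := PowerSeries.mk (fun k => risingFac (c - a - b) k / (Nat.factorial k)) with hP
  set F : PowerSeries ℝ := PowerSeries.mk (hgc a b c) with hF
  set D := PowerSeries.derivative ℝ with hD
  have e1 : (1 - X) * D P = (C c - C a - C b) * P := by
    rw [← map_sub, ← map_sub]
    ext n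
    have h3 : ((Nat.factorial n : ℕ) : ℝ) ≠ 0 := by positivity
    have h4 : (n : ℝ) + 1 ≠ 0 := by positivity
    rw [sub_mul, one_mul, map_sub, coeff_C_mul]
    rcases n with _ | n
    · simp [hP, hD, PowerSeries.coeff_derivative, risingFac]
    · rw [PowerSeries.coeff_succ_X_mul]
      simp only [hD, PowerSeries.coeff_derivative, hP, coeff_mk, risingFac, Nat.factorial_succ]
      have h5 : ((Nat.factorial n : ℕ) : ℝ) ≠ 0 := by positivity
      push_cast at h4 ⊢
      field_simp
      ring
  have e3 : X * (1 - X) * D (D F) + (C c - (C a + C b + 1) * X) * D F - C a * C b * F = 0 := by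
    have : X * (1 - X) * D (D F) + (C c - (C a + C b + 1) * X) * D F - C a * C b * F
      = X * D (D F) - X * (X * D (D F)) + C c * D F - C (a + b + 1) * (X * D F) - C (a * b) * F := by
      simp only [map_add, map_mul, map_one]; ring
    rw [this]
    ext n
    simp only [LinearMap.map_sub, LinearMap.map_add, coeff_C_mul, map_zero]
    rcases n with _ | _ | n
    · have := hgc_rec a b hc 0
      simp [hF, hD, PowerSeries.coeff_derivative] at this ⊢
      linarith
    · have := hgc_rec a b hc 1
      rw [PowerSeries.coeff_succ_X_mul,PowerSeries.coeff_succ_X_mul,PowerSeries.coeff_succ_X_mul]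
      simp [hF, hD, PowerSeries.coeff_derivative] at this ⊢
      linarith
    · have := hgc_rec a b hc (n + 2)
      rw [PowerSeries.coeff_succ_X_mul,PowerSeries.coeff_succ_X_mul,PowerSeries.coeff_succ_X_mul,
        PowerSeries.coeff_succ_X_mul]
      simp only [hF, hD, PowerSeries.coeff_derivative, coeff_mk] at this ⊢
      push_cast at this ⊢
      linear_combination this
  have e2 : (1 - X) * D (D P) = (C c - C a - C b + 1) * D P := by
    have := congrArg D e1
    simp only [Derivation.leibniz, map_sub, smul_eq_mul, hD, derivative_C, derivative_X,
      Derivation.map_one_eq_zero] at this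
    simp only [hD]
    linear_combination this
  have hH1 : D (P * F) = P * D F + F * D P := by simp [hD, Derivation.leibniz]
  have hH2 : D (D (P * F)) = P * D (D F) + 2 * (D P * D F) + F * D (D P) := by
    rw [hH1]; simp only [hD, Derivation.leibniz, map_add, smul_eq_mul]; ring
  set H := P * F with hH
  have eH : X * (1 - X) * D (D H) + (C c - (C (c - a) + C (c - b) + 1) * X) * D H
      - C (c - a) * C (c - b) * H = 0 := by
    have hx : (1 - X : PowerSeries ℝ) ≠ 0 := by
      intro h
      have := congrArg (PowerSeries.coeff 0) h
      simp at this
    apply mul_left_cancel₀ hx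
    rw [hH2, hH1, hH]
    simp only [map_sub]
    linear_combination (1 - X) * P * e3 + X * (1 - X) * F * e2 +
      (X * F * (C c - C a - C b + 1) + 2 * X * (1 - X) * D F
        + (C c - (C c - C a + (C c - C b) + 1) * X) * F) * e1
  have hrec : ∀ n : ℕ, (n + 1) * (c + n) * coeff (n + 1) H
      = (c - a + n) * (c - b + n) * coeff n H := by
    have : X * (1 - X) * D (D H) + (C c - (C (c - a) + C (c - b) + 1) * X) * D H
        - C (c - a) * C (c - b) * H
      = X * D (D H) - X * (X * D (D H)) + C c * D H - C ((c - a) + (c - b) + 1) * (X * D H)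
        - C ((c - a) * (c - b)) * H := by
      simp only [map_add, map_mul, map_one]; ring
    rw [this] at eH
    intro n
    have h := congrArg (coeff n) eH
    simp only [LinearMap.map_sub, LinearMap.map_add, coeff_C_mul, map_zero] at h
    rcases n with _ | _ | n
    · simp [hD, PowerSeries.coeff_derivative] at h ⊢
      linarith
    · rw [PowerSeries.coeff_succ_X_mul,PowerSeries.coeff_succ_X_mul,PowerSeries.coeff_succ_X_mul] at h
      simp [hD, PowerSeries.coeff_derivative] at h ⊢
      linarith
    · rw [PowerSeries.coeff_succ_X_mul,PowerSeries.coeff_succ_X_mul,PowerSeries.coeff_succ_X_mul,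
        PowerSeries.coeff_succ_X_mul] at h
      simp only [hD, PowerSeries.coeff_derivative] at h ⊢
      push_cast at h ⊢
      linear_combination h
  ext n
  rw [coeff_mk]
  induction n with
  | zero => simp [hH, hP, hF, hgc_zero, risingFac]
  | succ n ih =>
    have h1 := hrec n
    rw [ih, ← hgc_rec _ _ hc] at h1
    have h2 : ((n:ℝ) + 1) * (c + n) ≠ 0 := by positivity
    exact mul_left_cancel₀ h2 h1

lemma binom_coeff (s z : ℝ) (k : ℕ) : risingFac (-s) k / (Nat.factorial k) * z ^ k =
    (binomialSeries ℝ s k) fun _ => -z := by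
  have hk : (Nat.factorial k : ℝ) * Ring.choose s k = risingFac (-s) k * (-1) ^ k := by
    have h1 := Ring.descPochhammer_eq_factorial_smul_choose s k
    rw [nsmul_eq_mul] at h1
    rw [← h1]
    clear h1
    induction k with
    | zero => simp [risingFac]
    | succ k ih =>
      rw [descPochhammer_succ_right, Polynomial.smeval_mul, ih, risingFac, pow_succ]
      simp [Polynomial.smeval_sub, Polynomial.smeval_X, Polynomial.smeval_natCast]
      ring
  have h3 : ((Nat.factorial k : ℕ) : ℝ) ≠ 0 := by positivity
  rw [binomialSeries_apply]
  simp only [List.ofFn_const, List.prod_replicate, smul_eq_mul]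
  field_simp
  rw [mul_assoc, ← mul_assoc _ (Ring.choose s k), hk, neg_pow z, ← mul_assoc, mul_assoc _ _ ((-1)^k), ← mul_pow]
  simp

lemma binom_hasSum (s : ℝ) {z : ℝ} (hz : |z| < 1) :
    HasSum (fun k => risingFac (-s) k / (Nat.factorial k) * z ^ k) ((1 - z) ^ s) := by
  have h := (Real.one_add_rpow_hasFPowerSeriesOnBall_zero (a := s)).hasSum
    (y := -z) (by simpa [Metric.mem_eball, edist_dist, Real.dist_eq] using hz)
  simp only [zero_add] at h
  rw [← sub_eq_add_neg] at h
  have hfun : (fun k : ℕ => risingFac (-s) k / (Nat.factorial k) * z ^ k) =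
      fun n => (binomialSeries ℝ s n) fun _ => -z := by
    ext k
    exact binom_coeff s z k
  rw [hfun]
  exact h

lemma euler_hasSum (a b : ℝ) {c z : ℝ} (hc : 0 < c) (hz : |z| < 1)
    (hs : Summable fun k => hgc (c - a) (c - b) c k * z ^ k) :
    ∑' k, hgc a b c k * z ^ k =
      (1 - z) ^ (c - a - b) * ∑' k, hgc (c - a) (c - b) c k * z ^ k := by
  have hb := binom_hasSum (c - a - b) hz
  rw [← hb.tsum_eq, tsum_mul_tsum_eq_tsum_sum_antidiagonal_of_summable_norm hb.summable.norm hs.norm]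
  congr 1
  ext n
  have h := congrArg (PowerSeries.coeff n) (euler_ps (c - a) (c - b) hc)
  rw [PowerSeries.coeff_mul, PowerSeries.coeff_mk] at h
  simp only [PowerSeries.coeff_mk] at h
  rw [show c - (c - a) = a by ring, show c - (c - b) = b by ring,
    show a - (c - b) = -(c - a - b) by ring] at h
  rw [← h, Finset.sum_mul]
  refine Finset.sum_congr rfl fun p hp => ?_
  rw [← Finset.HasAntidiagonal.mem_antidiagonal.mp hp, pow_add]
  ring

lemma hgc_diff (a b : ℝ) {c : ℝ} (hc : 0 < c) (n : ℕ) :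
    n * hgc a b c n - (n + 1 : ℕ) * hgc a b c (n + 1) =
      hgc a b c n * (((c - a - b) * n - a * b) / (c + n)) := by
  have h := hgc_rec a b hc n
  have h2 : c + n ≠ 0 := by positivity
  push_cast
  field_simp
  linear_combination -h

lemma hgc_summable (a b : ℝ) {c : ℝ} (hc : 0 < c) (hs : 0 < c - a - b) :
    Summable (hgc a b c) := by
  obtain ⟨N, hN⟩ := exists_nat_gt (max (max (-a) (-b)) ((a * b + (c - a - b) * c / 2) / ((c - a - b) / 2)))
  rw [max_lt_iff, max_lt_iff] at hN
  obtain ⟨⟨h1, h2⟩, h3⟩ := hN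
  rw [div_lt_iff₀ (by positivity)] at h3
  rw [← summable_nat_add_iff N]
  have key : ∀ m : ℕ, (c - a - b) / 2 * |hgc a b c (m + N)| ≤
      (m + N : ℕ) * |hgc a b c (m + N)| - (m + 1 + N : ℕ) * |hgc a b c (m + 1 + N)| := by
    intro m
    have hd := hgc_diff a b hc (m + N)
    have hr := hgc_rec a b hc (m + N)
    have hm : (0:ℝ) ≤ m := by positivity
    have habs : (m + N + 1 : ℕ) * |hgc a b c (m + N + 1)| =
      (a + (m + N : ℕ)) * (b + (m + N : ℕ)) / (c + (m + N : ℕ)) * |hgc a b c (m + N)| := by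
      have h0 : ((m + N + 1 : ℕ) : ℝ) * hgc a b c (m + N + 1) =
        (a + (m + N : ℕ)) * (b + (m + N : ℕ)) / (c + (m + N : ℕ)) * hgc a b c (m + N) := by
        have : c + (m + N : ℕ) ≠ 0 := by positivity
        field_simp
        push_cast at hr ⊢
        linarith
      have h0' := congrArg abs h0
      rw [abs_mul, abs_mul, abs_of_nonneg (by positivity)] at h0'
      rw [h0', abs_of_nonneg]
      push_cast
      apply div_nonneg (mul_nonneg _ _) <;> first | positivity | linarith
    rw [show m + 1 + N = m + N + 1 by ring, habs, ← sub_mul]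
    refine mul_le_mul_of_nonneg_right ?_ (abs_nonneg _)
    have hpos : (0:ℝ) < c + (m + N : ℕ) := by positivity
    rw [le_sub_iff_add_le, ← le_sub_iff_add_le', div_le_iff₀ hpos]
    push_cast
    nlinarith [mul_nonneg hs.le hm]
  refine Summable.of_abs ?_
  refine summable_of_sum_range_le (c := (N * |hgc a b c N|) / ((c - a - b) / 2))
    (fun _ => abs_nonneg _) ?_
  intro n
  rw [le_div_iff₀ (by positivity), mul_comm, Finset.mul_sum]
  calc _ ≤ ∑ m ∈ Finset.range n, (((m + N : ℕ) : ℝ) * |hgc a b c (m + N)| - (m + 1 + N : ℕ) * |hgc a b c (m + 1 + N)|) :=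
        Finset.sum_le_sum fun m _ => key m
    _ = N * |hgc a b c N| - (n + N : ℕ) * |hgc a b c (n + N)| := by
        rw [Finset.sum_range_sub' (fun m : ℕ => ((m + N : ℕ) : ℝ) * |hgc a b c (m + N)|)]
        simp
    _ ≤ _ := by
        have : 0 ≤ ((n + N : ℕ) : ℝ) * |hgc a b c (n + N)| := by positivity
        linarith

lemma hgc_not_summable (a b : ℝ) {c : ℝ} (hc : 0 < c) (ha : 0 < a) (hb : 0 < b)
    (hs : c - a - b ≤ 0) : ¬ Summable (hgc a b c) := by
  intro h
  have hpos : ∀ n, 0 < hgc a b c n := fun n => by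
    have := rf_pos ha n
    have := rf_pos hb n
    have := rf_pos hc n
    unfold hgc
    positivity
  have hmono : ∀ n : ℕ, hgc a b c 1 ≤ (n + 1 : ℕ) * hgc a b c (n + 1) := by
    intro n
    induction n with
    | zero => simp
    | succ n ih =>
      have h1 := hgc_diff a b hc (n + 1)
      have h2 : hgc a b c (n + 1) * (((c - a - b) * (n + 1 : ℕ) - a * b) / (c + (n + 1 : ℕ))) ≤ 0 := by
        apply mul_nonpos_of_nonneg_of_nonpos (hpos _).le
        apply div_nonpos_of_nonpos_of_nonneg _ (by positivity)
        have : (c - a - b) * (n + 1 : ℕ) ≤ 0 := mul_nonpos_of_nonpos_of_nonneg hs (by positivity)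
        nlinarith [mul_pos ha hb]
      linarith
  have h1 := (summable_nat_add_iff 1).mpr h
  have h2 : Summable fun n : ℕ => hgc a b c 1 * (1 / ((n + 1 : ℕ) : ℝ)) := by
    refine Summable.of_nonneg_of_le (fun n => ?_) (fun n => ?_) h1
    · have := hpos 1; positivity
    · rw [mul_one_div, div_le_iff₀ (by positivity), mul_comm]
      exact hmono n
  rw [summable_mul_left_iff (hpos 1).ne', summable_nat_add_iff 1 (f := fun n : ℕ => 1 / (n : ℝ))] at h2
  exact Real.not_summable_one_div_natCast h2

open Filter Topology in
lemma nat_mul_tendsto_zero {f : ℕ → ℝ} (hf : Summable f) {l : ℝ}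
    (hl : Tendsto (fun n : ℕ => n * f n) atTop (𝓝 l)) : l = 0 := by
  by_contra hne
  have hl' := hl.abs
  have hpos : 0 < |l| := abs_pos.mpr hne
  have hev := hl'.eventually (lt_mem_nhds (half_lt_self hpos))
  obtain ⟨N, hN⟩ := eventually_atTop.mp hev
  have h2 : Summable fun n : ℕ => |l| / 2 * (1 / ((n + (N + 1) : ℕ) : ℝ)) := by
    refine Summable.of_nonneg_of_le (fun n => by positivity) (fun n => ?_)
      ((summable_nat_add_iff (N + 1)).mpr hf.abs)
    rw [mul_one_div, div_le_iff₀ (by positivity), mul_comm]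
    have := hN (n + (N + 1)) (by omega)
    rw [abs_mul, Nat.abs_cast] at this
    exact this.le
  rw [summable_mul_left_iff (by positivity), summable_nat_add_iff (N + 1) (f := fun n : ℕ => 1 / (n : ℝ))] at h2
  exact Real.not_summable_one_div_natCast h2

open Filter Topology in
lemma gauss_step (a b : ℝ) {c : ℝ} (hc : 0 < c) (hs : 0 < c - a - b) :
    c * (c - a - b) * ∑' n, hgc a b c n = (c - a) * (c - b) * ∑' n, hgc a b (c + 1) n := by
  have h1 := hgc_summable a b hc hs
  have h2 := hgc_summable a b (c := c + 1) (by linarith) (by linarith)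
  have hrf : ∀ n, risingFac (c + 1) n * c = risingFac c n * (c + n) := by
    intro n
    induction n with
    | zero => simp [risingFac]
    | succ n ih =>
      simp only [risingFac]
      push_cast
      linear_combination (c + 1 + n) * ih
  have hshift : ∀ n : ℕ, hgc a b (c + 1) n * (c + n) = c * hgc a b c n := by
    intro n
    have e1 := (rf_pos hc n).ne'
    have e2 := (rf_pos (show 0 < c + 1 by linarith) n).ne'
    have e3 : ((Nat.factorial n : ℕ) : ℝ) ≠ 0 := by positivity
    unfold hgc
    field_simp
    linear_combination (-(risingFac a n * risingFac b n)) * hrf n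
  have hterm : ∀ n : ℕ, c * (c - a - b) * hgc a b c n - (c - a) * (c - b) * hgc a b (c + 1) n =
      c * (n * hgc a b c n - (n + 1 : ℕ) * hgc a b c (n + 1)) := by
    intro n
    rw [hgc_diff a b hc n]
    have : c + n ≠ 0 := by positivity
    have hh := hshift n
    field_simp
    linear_combination (-((c - a) * (c - b))) * hh
  have hsum := ((h1.hasSum.mul_left (c * (c - a - b))).sub (h2.hasSum.mul_left ((c - a) * (c - b))))
  simp only [hterm] at hsum
  have ht := hsum.tendsto_sum_nat
  simp only [← Finset.mul_sum] at ht
  simp only [Finset.sum_range_sub' (fun n : ℕ => (n : ℝ) * hgc a b c n)] at ht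
  have ht2 := ht.const_mul (-c⁻¹)
  have : (fun n : ℕ => -c⁻¹ * (c * (((0:ℕ):ℝ) * hgc a b c 0 - n * hgc a b c n))) = fun n : ℕ => n * hgc a b c n := by
    ext n; field_simp; simp
  rw [this] at ht2
  have h0 := nat_mul_tendsto_zero h1 ht2
  have hc' : -c⁻¹ ≠ 0 := by simpa using hc.ne'
  have := (mul_eq_zero.mp h0).resolve_left hc'
  linarith

lemma rf_prod (x : ℝ) (n : ℕ) : risingFac x n = ∏ j ∈ Finset.range n, (x + j) := by
  induction n with
  | zero => simp [risingFac]
  | succ n ih => rw [risingFac, ih, Finset.prod_range_succ]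

open Filter Topology in
lemma gauss_sum (a b : ℝ) {c : ℝ} (hc : 0 < c) (hs : 0 < c - a - b) (hca : 0 < c - a)
    (hcb : 0 < c - b) : ∑' n, hgc a b c n =
      Real.Gamma c * Real.Gamma (c - a - b) / (Real.Gamma (c - a) * Real.Gamma (c - b)) := by
  have hiter : ∀ m : ℕ, risingFac c m * risingFac (c - a - b) m * ∑' n, hgc a b c n =
      risingFac (c - a) m * risingFac (c - b) m * ∑' n, hgc a b (c + m) n := by
    intro m
    induction m with
    | zero => simp [risingFac]
    | succ m ih =>
      have hm : (0:ℝ) ≤ m := by positivity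
      have := gauss_step a b (c := c + m) (by linarith) (by linarith)
      simp only [risingFac]
      push_cast
      rw [← add_assoc c]
      linear_combination (c + m) * (c - a - b + m) * ih
        + risingFac (c - a) m * risingFac (c - b) m * this
  have hrfmono : ∀ m n : ℕ, risingFac c n ≤ risingFac (c + m) n := by
    intro m n
    rw [rf_prod, rf_prod]
    apply Finset.prod_le_prod
    · intros; positivity
    · intros
      have hm : (0:ℝ) ≤ m := by positivity
      linarith
  have hlim : Tendsto (fun m : ℕ => ∑' n, hgc a b (c + m) n) atTop (𝓝 1) := by
    have h1 : ∑' n : ℕ, (if n = 0 then (1:ℝ) else 0) = 1 := by simp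
    rw [← h1]
    refine tendsto_tsum_of_dominated_convergence (bound := fun n => |hgc a b c n|)
      (hgc_summable a b hc hs).abs ?_ ?_
    · intro n
      rcases n with _ | n
      · simp [hgc_zero]
      · simp only [Nat.add_eq_zero_iff, one_ne_zero, and_false, if_false]
        unfold hgc
        apply Tendsto.div_atTop tendsto_const_nhds
        apply Tendsto.atTop_mul_const (by positivity)
        refine tendsto_atTop_mono (f := fun m : ℕ => risingFac c n * ((m:ℕ):ℝ)) ?_ ?_
        · intro m
          simp only [risingFac]
          apply mul_le_mul (hrfmono m n) _ (by positivity) (rf_pos (by positivity) n).le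
          have : (0:ℝ) ≤ n := by positivity
          linarith
        · exact Tendsto.const_mul_atTop (rf_pos hc n) tendsto_natCast_atTop_atTop
    · refine Eventually.of_forall fun m n => ?_
      rw [Real.norm_eq_abs]
      unfold hgc
      rw [abs_div, abs_div]
      have e1 := rf_pos hc n
      have e2 := rf_pos (show 0 < c + m by positivity) n
      have e3 : (0:ℝ) < ((Nat.factorial n : ℕ) : ℝ) := by positivity
      rw [abs_of_pos (mul_pos e1 e3), abs_of_pos (mul_pos e2 e3)]
      gcongr
      exact hrfmono m n
  have hG := ((Real.GammaSeq_tendsto_Gamma c).mul (Real.GammaSeq_tendsto_Gamma (c - a - b))).div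
    ((Real.GammaSeq_tendsto_Gamma (c - a)).mul (Real.GammaSeq_tendsto_Gamma (c - b)))
    (mul_ne_zero (Real.Gamma_pos_of_pos hca).ne' (Real.Gamma_pos_of_pos hcb).ne')
  have hG2 := hG.mul ((tendsto_add_atTop_iff_nat 1).mpr hlim)
  rw [mul_one] at hG2
  refine tendsto_nhds_unique (tendsto_const_nhds.congr' ?_) hG2
  filter_upwards [eventually_gt_atTop 0] with n hn
  have hn' : (0:ℝ) < n := by exact_mod_cast hn
  have hi := hiter (n + 1)
  have e1 := (rf_pos hc (n + 1)).ne'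
  have e2 := (rf_pos hs (n + 1)).ne'
  have e3 := (rf_pos hca (n + 1)).ne'
  have e4 := (rf_pos hcb (n + 1)).ne'
  simp only [Pi.div_apply, Real.GammaSeq, ← rf_prod]
  have hp : (n:ℝ) ^ c * (n:ℝ) ^ (c - a - b) = (n:ℝ) ^ (c - a) * (n:ℝ) ^ (c - b) := by
    rw [← Real.rpow_add hn', ← Real.rpow_add hn']; congr 1; ring
  have p1 := (Real.rpow_pos_of_pos hn' (c - a)).ne'
  have p2 := (Real.rpow_pos_of_pos hn' (c - b)).ne'
  have e5 : ((Nat.factorial n : ℕ) : ℝ) ≠ 0 := by positivity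
  have : (n:ℝ) ^ c * (Nat.factorial n) / risingFac c (n + 1) * ((n:ℝ) ^ (c - a - b) * (Nat.factorial n) / risingFac (c - a - b) (n + 1)) /
    ((n:ℝ) ^ (c - a) * (Nat.factorial n) / risingFac (c - a) (n + 1) * ((n:ℝ) ^ (c - b) * (Nat.factorial n) / risingFac (c - b) (n + 1)))
    = risingFac (c - a) (n + 1) * risingFac (c - b) (n + 1) / (risingFac c (n + 1) * risingFac (c - a - b) (n + 1)) := by
    rw [div_eq_div_iff (by positivity) (by positivity)]
    field_simp
    linear_combination hp
  rw [this, div_mul_eq_mul_div, eq_div_iff (by positivity)]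
  linarith

lemma measurable_rsign : Measurable Real.sign := by
  unfold Real.sign
  refine Measurable.ite measurableSet_Iio measurable_const ?_
  exact Measurable.ite measurableSet_Ioi measurable_const measurable_const

lemma abs_rsign_le (x : ℝ) : |Real.sign x| ≤ 1 := by
  rcases Real.sign_apply_eq x with h | h | h <;> rw [h] <;> norm_num

/-- signed power -/
def fsg (a x : ℝ) : ℝ := Real.sign x * |x| ^ a

lemma measurable_fsg (a : ℝ) : Measurable (fsg a) := by
  unfold fsg
  exact measurable_rsign.mul (by fun_prop)

lemma abs_fsg_le (a x : ℝ) : |fsg a x| ≤ |x| ^ a := by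
  unfold fsg
  rw [abs_mul, abs_of_nonneg (Real.rpow_nonneg (abs_nonneg x) a)]
  exact mul_le_of_le_one_left (by positivity) (abs_rsign_le x)

lemma int_abs {q β : ℝ} (hq : -1 < q) (hβ : 0 < β) :
    Integrable fun x : ℝ => |x| ^ q * Real.exp (-β * x ^ 2) := by
  have h1 : IntegrableOn (fun x : ℝ => |x| ^ q * Real.exp (-β * x ^ 2)) (Ioi 0) := by
    refine (integrableOn_rpow_mul_exp_neg_mul_sq hβ hq).congr_fun ?_ measurableSet_Ioi
    intro x hx
    simp only [abs_of_pos (mem_Ioi.mp hx)]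
  have h2 : IntegrableOn (fun x : ℝ => |x| ^ q * Real.exp (-β * x ^ 2)) (Iio 0) := by
    have := h1.comp_neg
    simpa using this
  have h3 : IntegrableOn (fun x : ℝ => |x| ^ q * Real.exp (-β * x ^ 2)) (Iio 0 ∪ (Ioi 0 ∪ {0})) := h2.union (h1.union (integrableOn_singleton (x := (0:ℝ)) (by simp) (by simp)))
  rw [← integrableOn_univ]
  refine h3.mono_set ?_
  intro x _
  rcases lt_trichotomy x 0 with h | h | h <;> simp [h]

lemma integral_abs_gauss {q β : ℝ} (hq : -1 < q) (hβ : 0 < β) :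
    ∫ x : ℝ, |x| ^ q * Real.exp (-β * x ^ 2) = β ^ (-(q + 1) / 2) * Real.Gamma ((q + 1) / 2) := by
  have h := integral_comp_abs (f := fun x : ℝ => x ^ q * Real.exp (-β * x ^ 2))
  simp only [sq_abs] at h
  rw [h]
  have h2 := integral_rpow_mul_exp_neg_mul_rpow (p := 2) (by norm_num) hq hβ
  simp only [Real.rpow_two] at h2
  rw [h2]
  ring

lemma not_int_abs {q β : ℝ} (hq : q ≤ -1) :
    ¬ Integrable fun x : ℝ => |x| ^ q * Real.exp (-β * x ^ 2) := by
  intro h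
  have h1 := h.integrableOn (s := Ioo 0 1)
  have h2 : IntegrableOn (fun x : ℝ => Real.exp (β * x ^ 2) * (|x| ^ q * Real.exp (-β * x ^ 2))) (Ioo 0 1) := by
    refine Integrable.bdd_mul (c := Real.exp |β|) h1 (by fun_prop) ?_
    refine (ae_restrict_iff' measurableSet_Ioo).mpr (Filter.Eventually.of_forall fun x hx => ?_)
    rw [Real.norm_eq_abs, abs_of_pos (Real.exp_pos _), Real.exp_le_exp]
    have hx2 : x ^ 2 ≤ 1 := by nlinarith [hx.1, hx.2]
    nlinarith [le_abs_self β, abs_nonneg β, sq_nonneg x]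
  have h3 : IntegrableOn (fun x : ℝ => x ^ q) (Ioo 0 1) := by
    refine h2.congr_fun ?_ measurableSet_Ioo
    intro x hx
    simp only
    rw [abs_of_pos hx.1, mul_left_comm, ← Real.exp_add]
    simp
  rw [intervalIntegral.integrableOn_Ioo_rpow_iff one_pos] at h3
  linarith

lemma int_fsg {a v : ℝ} (ha : -1 < a) (hv : 0 < v) (k : ℕ) :
    ∫ x : ℝ, x ^ (2 * k + 1) * (fsg a x * Real.exp (-x ^ 2 / (2 * v))) =
      (2 * v) ^ (a / 2 + 1 + k) * Real.Gamma (a / 2 + 1 + k) := by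
  have hk : (0:ℝ) ≤ k := by positivity
  have h := integral_abs_gauss (q := a + (2 * k + 1)) (β := (2 * v)⁻¹) (by linarith) (by positivity)
  rw [show -(a + (2 * k + 1) + 1) / 2 = -(a / 2 + 1 + k) by ring,
    show (a + (2 * k + 1) + 1) / 2 = a / 2 + 1 + k by ring, Real.inv_rpow (by positivity),
    Real.rpow_neg (by positivity), inv_inv] at h
  rw [← h]
  congr 1
  ext x
  rcases eq_or_ne x 0 with rfl | hx
  · have : a + (2 * k + 1) ≠ 0 := by linarith
    simp [Real.zero_rpow this]
  · have hx' : 0 < |x| := abs_pos.mpr hx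
    have e : x ^ (2 * k + 1) * Real.sign x = |x| ^ (2 * k + 1) := by
      rcases lt_or_gt_of_ne hx with h0 | h0
      · rw [Real.sign_of_neg h0, abs_of_neg h0, Odd.neg_pow ⟨k, rfl⟩]; ring
      · rw [Real.sign_of_pos h0, abs_of_pos h0]; ring
    rw [fsg, Real.rpow_add hx', ← mul_assoc, ← mul_assoc, e]
    have e2 : |x| ^ ((2 * k + 1 : ℝ)) = |x| ^ (2 * k + 1) := by
      rw [← Real.rpow_natCast]; push_cast; rfl
    rw [e2, mul_comm (|x| ^ a)]
    congr 2
    rw [neg_div, neg_mul, div_eq_inv_mul]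

lemma int_fsg_even (a v : ℝ) (k : ℕ) :
    ∫ x : ℝ, x ^ (2 * k) * (fsg a x * Real.exp (-x ^ 2 / (2 * v))) = 0 := by
  have h := integral_neg_eq_self (fun x : ℝ => x ^ (2 * k) * (fsg a x * Real.exp (-x ^ 2 / (2 * v)))) volume
  have h2 : ∀ x : ℝ, (-x) ^ (2 * k) * (fsg a (-x) * Real.exp (-(-x) ^ 2 / (2 * v))) =
      -(x ^ (2 * k) * (fsg a x * Real.exp (-x ^ 2 / (2 * v)))) := by
    intro x
    have e : Real.sign (-x) = - Real.sign x := by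
      rcases lt_trichotomy x 0 with h | h | h
      · rw [Real.sign_of_neg h, Real.sign_of_pos (by linarith)]; ring
      · simp [h]
      · rw [Real.sign_of_pos h, Real.sign_of_neg (by linarith)]
    rw [fsg, fsg, e, abs_neg, neg_sq, Even.neg_pow ⟨k, by ring⟩]
    ring
  simp only [h2] at h
  rw [integral_neg] at h
  linarith

/-- kernel -/
def ker (ρ v a b : ℝ) (p : ℝ × ℝ) : ℝ :=
  Real.exp (ρ / v * (p.1 * p.2)) * ((fsg a p.1 * Real.exp (-p.1 ^ 2 / (2 * v))) *
    (fsg b p.2 * Real.exp (-p.2 ^ 2 / (2 * v))))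

lemma measurable_ker (ρ v a b : ℝ) : Measurable (ker ρ v a b) := by
  unfold ker
  have h1 : Measurable fun p : ℝ × ℝ => fsg a p.1 := (measurable_fsg a).comp measurable_fst
  have h2 : Measurable fun p : ℝ × ℝ => fsg b p.2 := (measurable_fsg b).comp measurable_snd
  refine Measurable.mul (by fun_prop) ((h1.mul (by fun_prop)).mul (h2.mul (by fun_prop)))

lemma ker_dom {ρ v a b : ℝ} (ha : -1 < a) (hb : -1 < b) (hv : 0 < v) (hρ : |ρ| < 1) :
    Integrable (fun p : ℝ × ℝ => Real.exp (|ρ / v * (p.1 * p.2)|) *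
      |(fsg a p.1 * Real.exp (-p.1 ^ 2 / (2 * v))) *
        (fsg b p.2 * Real.exp (-p.2 ^ 2 / (2 * v)))|) (volume.prod volume) := by
  set κ := (1 - |ρ|) / (2 * v) with hκ
  have hκ0 : 0 < κ := by
    have : 0 < 1 - |ρ| := by linarith
    positivity
  have hd := (int_abs ha hκ0).mul_prod (int_abs hb hκ0)
  refine hd.mono' ?_ ?_
  · have h1 : Measurable fun p : ℝ × ℝ => fsg a p.1 := (measurable_fsg a).comp measurable_fst
    have h2 : Measurable fun p : ℝ × ℝ => fsg b p.2 := (measurable_fsg b).comp measurable_snd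
    have h3 : Measurable fun p : ℝ × ℝ => (fsg a p.1 * Real.exp (-p.1 ^ 2 / (2 * v))) *
        (fsg b p.2 * Real.exp (-p.2 ^ 2 / (2 * v))) :=
      (h1.mul (by fun_prop)).mul (h2.mul (by fun_prop))
    have h4 : Measurable fun p : ℝ × ℝ => Real.exp (|ρ / v * (p.1 * p.2)|) := by fun_prop
    exact (h4.mul h3.abs).aestronglyMeasurable
  · refine Filter.Eventually.of_forall fun p => ?_
    obtain ⟨x, y⟩ := p
    simp only
    rw [Real.norm_eq_abs, abs_mul, abs_abs, Real.abs_exp, abs_mul (fsg a x * _), abs_mul (fsg a x), abs_mul (fsg b y), Real.abs_exp, Real.abs_exp]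
    have e : Real.exp |ρ / v * (x * y)| * (Real.exp (-x ^ 2 / (2 * v)) * Real.exp (-y ^ 2 / (2 * v))) ≤
        Real.exp (-κ * x ^ 2) * Real.exp (-κ * y ^ 2) := by
      rw [← Real.exp_add, ← Real.exp_add, ← Real.exp_add, Real.exp_le_exp, abs_mul, abs_div, abs_mul,
        abs_of_pos hv, hκ]
      have : |x| * |y| ≤ (x ^ 2 + y ^ 2) / 2 := by
        nlinarith [sq_nonneg (|x| - |y|), sq_abs x, sq_abs y]
      have h3 := mul_le_mul_of_nonneg_left this (show 0 ≤ |ρ| / v by positivity)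
      have : -((1 - |ρ|) / (2 * v)) * x ^ 2 + -((1 - |ρ|) / (2 * v)) * y ^ 2 =
        |ρ| / v * ((x ^ 2 + y ^ 2) / 2) + (-x ^ 2 / (2 * v) + -y ^ 2 / (2 * v)) := by
        field_simp; ring
      rw [this]
      linarith
    have h5 : |fsg a x| * |fsg b y| ≤ |x| ^ a * |y| ^ b :=
      mul_le_mul (abs_fsg_le a x) (abs_fsg_le b y) (abs_nonneg _) (by positivity)
    calc _ = (|fsg a x| * |fsg b y|) * (Real.exp |ρ / v * (x * y)| * (Real.exp (-x ^ 2 / (2 * v)) * Real.exp (-y ^ 2 / (2 * v)))) := by ring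
      _ ≤ (|x| ^ a * |y| ^ b) * (Real.exp (-κ * x ^ 2) * Real.exp (-κ * y ^ 2)) :=
        mul_le_mul h5 e (by positivity) (by positivity)
      _ = _ := by ring

lemma ker_int {ρ v a b : ℝ} (ha : -1 < a) (hb : -1 < b) (hv : 0 < v) (hρ : |ρ| < 1) :
    Integrable (ker ρ v a b) (volume.prod volume) := by
  refine (ker_dom ha hb hv hρ).mono' (measurable_ker ρ v a b).aestronglyMeasurable ?_
  refine Filter.Eventually.of_forall fun p => ?_
  unfold ker
  rw [Real.norm_eq_abs, abs_mul, Real.abs_exp]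
  gcongr
  exact le_abs_self _

lemma exp_hasSum (x : ℝ) : HasSum (fun n : ℕ => x ^ n / (Nat.factorial n)) (Real.exp x) := by
  have := NormedSpace.expSeries_div_hasSum_exp (𝔸 := ℝ) x
  rwa [← Real.exp_eq_exp_ℝ] at this

lemma ker_hasSum {ρ v a b : ℝ} (ha : -1 < a) (hb : -1 < b) (hv : 0 < v) (hρ : |ρ| < 1) :
    HasSum (fun k : ℕ => (ρ / v) ^ (2 * k + 1) / (Nat.factorial (2 * k + 1)) *
      (((2 * v) ^ (a / 2 + 1 + k) * Real.Gamma (a / 2 + 1 + k)) *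
       ((2 * v) ^ (b / 2 + 1 + k) * Real.Gamma (b / 2 + 1 + k))))
      (∫ p, ker ρ v a b p ∂(volume.prod volume)) := by
  set w : ℝ × ℝ → ℝ := fun p => (fsg a p.1 * Real.exp (-p.1 ^ 2 / (2 * v))) *
        (fsg b p.2 * Real.exp (-p.2 ^ 2 / (2 * v))) with hw
  have hwm : Measurable w := by
    have h1 : Measurable fun p : ℝ × ℝ => fsg a p.1 := (measurable_fsg a).comp measurable_fst
    have h2 : Measurable fun p : ℝ × ℝ => fsg b p.2 := (measurable_fsg b).comp measurable_snd
    exact (h1.mul (by fun_prop)).mul (h2.mul (by fun_prop))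
  have hb1 : ∀ p : ℝ × ℝ, HasSum (fun n : ℕ => |ρ / v * (p.1 * p.2)| ^ n / (Nat.factorial n) * |w p|)
      (Real.exp (|ρ / v * (p.1 * p.2)|) * |w p|) := fun p => (exp_hasSum _).mul_right _
  have key := hasSum_integral_of_dominated_convergence (μ := (volume : Measure ℝ).prod (volume : Measure ℝ))
    (F := fun (n : ℕ) (p : ℝ × ℝ) => (ρ / v * (p.1 * p.2)) ^ n / (Nat.factorial n) * w p)
    (f := ker ρ v a b)
    (fun n p => |ρ / v * (p.1 * p.2)| ^ n / (Nat.factorial n) * |w p|)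
    (fun n => by
      have : Measurable fun p : ℝ × ℝ => (ρ / v * (p.1 * p.2)) ^ n / (Nat.factorial n) := by fun_prop
      exact (this.mul hwm).aestronglyMeasurable)
    (fun n => Filter.Eventually.of_forall fun p => by
      rw [Real.norm_eq_abs, abs_mul, abs_div, abs_pow, Nat.abs_cast])
    (Filter.Eventually.of_forall fun p => (hb1 p).summable)
    (by
      simp only [fun p => (hb1 p).tsum_eq]
      exact ker_dom ha hb hv hρ)
    (Filter.Eventually.of_forall fun p => (exp_hasSum _).mul_right _)
  have hI : ∀ n : ℕ, ∫ p : ℝ × ℝ, (ρ / v * (p.1 * p.2)) ^ n / (Nat.factorial n) * w p ∂(volume.prod volume) =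
      (ρ / v) ^ n / (Nat.factorial n) * ((∫ x : ℝ, x ^ n * (fsg a x * Real.exp (-x ^ 2 / (2 * v)))) *
        (∫ x : ℝ, x ^ n * (fsg b x * Real.exp (-x ^ 2 / (2 * v))))) := by
    intro n
    rw [← integral_prod_mul, ← integral_const_mul]
    congr 1
    ext p
    simp only [hw]
    rw [mul_pow, mul_pow]
    ring
  simp only [hI] at key
  have hinj : Function.Injective fun k : ℕ => 2 * k + 1 := fun i j h => by simpa using h
  rw [← hinj.hasSum_iff] at key
  · simp only [Function.comp_def, int_fsg ha hv, int_fsg hb hv] at key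
    exact key
  · intro n hn
    rcases Nat.even_or_odd' n with ⟨k, rfl | rfl⟩
    · rw [int_fsg_even]; simp
    · exact absurd ⟨k, rfl⟩ hn

lemma corr_eq {ρ a b : ℝ} (ha : -1 < a) (hb : -1 < b) (hρ : |ρ| < 1) :
    corrExp ρ (fun g₁ g₂ => (Real.sign g₁ * |g₁| ^ a) * (Real.sign g₂ * |g₂| ^ b)) =
      (2 * π)⁻¹ * ((√(1 - ρ ^ 2))⁻¹ * ∫ p, ker ρ (1 - ρ ^ 2) a b p ∂(volume.prod volume)) := by
  have hv : 0 < 1 - ρ ^ 2 := by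
    rw [abs_lt] at hρ; nlinarith [hρ.1, hρ.2]
  set v := 1 - ρ ^ 2 with hvdef
  have hσ : 0 < √v := Real.sqrt_pos.mpr hv
  have hσ2 : √v ^ 2 = v := Real.sq_sqrt hv.le
  have hK := ker_int ha hb hv hρ
  unfold corrExp
  simp only [integral_gaussianReal_eq_integral_smul (one_ne_zero), smul_eq_mul]
  have hpt : ∀ t s : ℝ, gaussianPDFReal 0 1 t * (gaussianPDFReal 0 1 s *
      (Real.sign (ρ * s + √v * t) * |ρ * s + √v * t| ^ a * (Real.sign s * |s| ^ b))) =
      (2 * π)⁻¹ * ker ρ v a b (ρ * s + √v * t, s) := by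
    intro t s
    simp only [gaussianPDFReal, ker, fsg, NNReal.coe_one, mul_one, sub_zero]
    have e1 : (√(2 * π))⁻¹ * (√(2 * π))⁻¹ = (2 * π)⁻¹ := by
      rw [← mul_inv, Real.mul_self_sqrt (by positivity)]
    have e2 : Real.exp (-t ^ 2 / 2) * Real.exp (-s ^ 2 / 2) =
        Real.exp (ρ / v * ((ρ * s + √v * t) * s)) * (Real.exp (-(ρ * s + √v * t) ^ 2 / (2 * v)) *
          Real.exp (-s ^ 2 / (2 * v))) := by
      rw [← Real.exp_add, ← Real.exp_add, ← Real.exp_add]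
      congr 1
      field_simp
      have : v = 1 - ρ ^ 2 := hvdef
      linear_combination (-t ^ 2) * (-hσ2) + s ^ 2 * (- this)
    rw [← e1]
    linear_combination ((√(2 * π))⁻¹ * (√(2 * π))⁻¹ * (Real.sign (ρ * s + √v * t) * |ρ * s + √v * t| ^ a * (Real.sign s * |s| ^ b))) * e2
  have step : ∀ t : ℝ, gaussianPDFReal 0 1 t * (∫ s, gaussianPDFReal 0 1 s *
      (Real.sign (ρ * s + √v * t) * |ρ * s + √v * t| ^ a * (Real.sign s * |s| ^ b))) =
      ∫ s, (2 * π)⁻¹ * ker ρ v a b (ρ * s + √v * t, s) := by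
    intro t
    rw [← integral_const_mul]
    exact integral_congr_ae (Filter.Eventually.of_forall fun s => hpt t s)
  refine (integral_congr_ae (Filter.Eventually.of_forall step)).trans ?_
  have hsub : ∀ (f : ℝ → ℝ) (c : ℝ), ∫ t, f (c + √v * t) = (√v)⁻¹ * ∫ x, f x := by
    intro f c
    rw [Measure.integral_comp_mul_left (fun x => f (c + x)) (√v), integral_add_left_eq_self f c,
      abs_of_pos (by positivity), smul_eq_mul]
  have hHint : Integrable (Function.uncurry fun t s : ℝ => (2 * π)⁻¹ * ker ρ v a b (ρ * s + √v * t, s))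
      (volume.prod volume) := by
    have hmeas : Measurable (Function.uncurry fun t s : ℝ => (2 * π)⁻¹ * ker ρ v a b (ρ * s + √v * t, s)) := by
      have h1 : Measurable fun p : ℝ × ℝ => (ρ * p.2 + √v * p.1, p.2) := by fun_prop
      exact ((measurable_ker ρ v a b).comp h1).const_mul _
    rw [integrable_prod_iff' hmeas.aestronglyMeasurable]
    obtain ⟨h1, h2⟩ := (integrable_prod_iff' hK.aestronglyMeasurable).mp hK
    constructor
    · filter_upwards [h1] with s hs
      exact ((hs.comp_add_left (ρ * s)).comp_mul_left' hσ.ne').const_mul _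
    · have h3 := (h2.const_mul (√v)⁻¹).const_mul (2 * π)⁻¹
      refine h3.congr (Filter.Eventually.of_forall fun s => ?_)
      simp only [Function.uncurry, norm_mul]
      rw [integral_const_mul, hsub (fun x => ‖ker ρ v a b (x, s)‖) (ρ * s), Real.norm_of_nonneg (by positivity)]
  rw [integral_integral_swap hHint, integral_prod_symm _ hK, ← integral_const_mul, ← integral_const_mul]
  congr 1
  ext s
  rw [integral_const_mul, hsub (fun x => ker ρ v a b (x, s)) (ρ * s)]

lemma gaussNorm_pow {a : ℝ} (ha : -1 < a) : gaussNorm (a + 1) ^ (a + 1) =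
    (√(2 * π))⁻¹ * ((2:ℝ) ^ (a / 2 + 1) * Real.Gamma (a / 2 + 1)) := by
  have h1 : 0 < a + 1 := by linarith
  unfold gaussNorm
  rw [← Real.rpow_mul (integral_nonneg fun x => by positivity), one_div, inv_mul_cancel₀ h1.ne', Real.rpow_one]
  have h := integral_abs_gauss (q := a + 1) (β := 2⁻¹) (by linarith) (by positivity)
  rw [show -(a + 1 + 1) / 2 = -(a / 2 + 1) by ring,
    show (a + 1 + 1) / 2 = a / 2 + 1 by ring, Real.inv_rpow (by positivity),
    Real.rpow_neg (by positivity), inv_inv] at h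
  rw [← h, ← integral_const_mul]
  congr 1
  ext x
  rw [show -x ^ 2 / 2 = -2⁻¹ * x ^ 2 by ring]
  ring

lemma gamma_rf {x : ℝ} (hx : 0 < x) (k : ℕ) : Real.Gamma (x + k) = Real.Gamma x * risingFac x k := by
  induction k with
  | zero => simp [risingFac]
  | succ k ih =>
    push_cast
    rw [← add_assoc, Real.Gamma_add_one (by positivity), ih, risingFac]
    ring

lemma fact_rf (k : ℕ) : ((Nat.factorial (2 * k + 1) : ℕ) : ℝ) =
    4 ^ k * (risingFac (3 / 2) k * (Nat.factorial k)) := by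
  induction k with
  | zero => simp [risingFac]
  | succ k ih =>
    rw [show 2 * (k + 1) + 1 = (2 * k + 1) + 1 + 1 by ring, Nat.factorial_succ, Nat.factorial_succ,
      Nat.factorial_succ k, risingFac]
    push_cast
    rw [ih]
    ring

lemma term_eq {ρ a b : ℝ} (ha : -1 < a) (hb : -1 < b) (hv : 0 < 1 - ρ ^ 2) (k : ℕ) :
    (2 * π)⁻¹ * ((√(1 - ρ ^ 2))⁻¹ * ((ρ / (1 - ρ ^ 2)) ^ (2 * k + 1) / (Nat.factorial (2 * k + 1)) *
      (((2 * (1 - ρ ^ 2)) ^ (a / 2 + 1 + k) * Real.Gamma (a / 2 + 1 + k)) *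
       ((2 * (1 - ρ ^ 2)) ^ (b / 2 + 1 + k) * Real.Gamma (b / 2 + 1 + k))))) =
    (gaussNorm (a + 1) ^ (a + 1) * gaussNorm (b + 1) ^ (b + 1) * (1 - ρ ^ 2) ^ ((a + b + 1) / 2)) * ρ *
      (hgc (a / 2 + 1) (b / 2 + 1) (3 / 2) k * (ρ ^ 2) ^ k) := by
  set v := 1 - ρ ^ 2 with hvd
  rw [gaussNorm_pow ha, gaussNorm_pow hb, gamma_rf (by linarith), gamma_rf (by linarith), fact_rf,
    Real.rpow_add (by positivity), Real.rpow_add (by positivity) (b / 2 + 1), Real.rpow_natCast,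
    Real.mul_rpow (by norm_num) hv.le, Real.mul_rpow (by norm_num) hv.le]
  have e1 : (√(2 * π))⁻¹ * (√(2 * π))⁻¹ = (2 * π)⁻¹ := by
    rw [← mul_inv, Real.mul_self_sqrt (by positivity)]
  have e2 : v ^ (a / 2 + 1) * v ^ (b / 2 + 1) = v ^ ((a + b + 1) / 2) * √v * v := by
    rw [Real.sqrt_eq_rpow, ← Real.rpow_add hv, ← Real.rpow_add hv, ← Real.rpow_add_one hv.ne']
    congr 1; ring
  have hσ : √v ≠ 0 := (Real.sqrt_pos.mpr hv).ne'
  have e3 : (ρ / v) ^ (2 * k + 1) * ((2 * v) ^ k * (2 * v) ^ k * v) = 4 ^ k * (ρ * (ρ ^ 2) ^ k) := by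
    have hvn := hv.ne'
    rw [div_pow]
    field_simp
    rw [mul_pow, ← pow_mul, mul_pow, show (4:ℝ) = 2 ^ 2 by norm_num, ← pow_mul 2 2 k]
    ring
  have r1 := (rf_pos (show (0:ℝ) < 3 / 2 by norm_num) k).ne'
  have r2 : ((Nat.factorial k : ℕ) : ℝ) ≠ 0 := by positivity
  calc _ = (2 * π)⁻¹ * (√v)⁻¹ * (2 ^ (a / 2 + 1) * 2 ^ (b / 2 + 1)) * (v ^ (a / 2 + 1) * v ^ (b / 2 + 1)) *
        (Real.Gamma (a / 2 + 1) * Real.Gamma (b / 2 + 1)) * ((ρ / v) ^ (2 * k + 1) * ((2 * v) ^ k * (2 * v) ^ k))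
        * (risingFac (a / 2 + 1) k * risingFac (b / 2 + 1) k / (4 ^ k * (risingFac (3 / 2) k * (Nat.factorial k)))) := by ring
    _ = (2 * π)⁻¹ * ((√v)⁻¹ * √v) * (2 ^ (a / 2 + 1) * 2 ^ (b / 2 + 1)) * v ^ ((a + b + 1) / 2) *
        (Real.Gamma (a / 2 + 1) * Real.Gamma (b / 2 + 1)) * ((ρ / v) ^ (2 * k + 1) * ((2 * v) ^ k * (2 * v) ^ k * v))
        * (risingFac (a / 2 + 1) k * risingFac (b / 2 + 1) k / (4 ^ k * (risingFac (3 / 2) k * (Nat.factorial k)))) := by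
          rw [e2]; ring
    _ = _ := by
      rw [e3, inv_mul_cancel₀ hσ, ← e1, hgc]
      field_simp

lemma case_interior {ρ a b : ℝ} (ha : -1 < a) (hb : -1 < b) (hρ : |ρ| < 1) :
    corrExp ρ (fun g₁ g₂ => (Real.sign g₁ * |g₁| ^ a) * (Real.sign g₂ * |g₂| ^ b)) =
      gaussNorm (a + 1) ^ (a + 1) * gaussNorm (b + 1) ^ (b + 1) *
        (ρ * ∑' k : ℕ, hgc ((1 - a) / 2) ((1 - b) / 2) (3 / 2) k * (ρ ^ 2) ^ k) := by
  have hv : 0 < 1 - ρ ^ 2 := by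
    rw [abs_lt] at hρ; nlinarith [hρ.1, hρ.2]
  have hz : |ρ ^ 2| < 1 := by rw [abs_of_nonneg (sq_nonneg ρ)]; linarith
  have h := ((ker_hasSum ha hb hv hρ).mul_left (√(1 - ρ ^ 2))⁻¹).mul_left (2 * π)⁻¹
  rw [← corr_eq ha hb hρ] at h
  simp only [term_eq ha hb hv] at h
  have hA : ∀ {a : ℝ}, -1 < a → gaussNorm (a + 1) ^ (a + 1) ≠ 0 := by
    intro a ha
    rw [gaussNorm_pow ha]
    have := Real.Gamma_pos_of_pos (show 0 < a / 2 + 1 by linarith)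
    positivity
  have hsum : Summable fun k => hgc (3 / 2 - (1 - a) / 2) (3 / 2 - (1 - b) / 2) (3 / 2) k * (ρ ^ 2) ^ k := by
    rw [show 3 / 2 - (1 - a) / 2 = a / 2 + 1 by ring, show 3 / 2 - (1 - b) / 2 = b / 2 + 1 by ring]
    rcases eq_or_ne ρ 0 with h0 | h0
    · refine summable_of_ne_finset_zero (s := {0}) ?_
      intro k hk
      have : k ≠ 0 := by simpa using hk
      simp [h0, this]
    · refine (summable_mul_left_iff ?_).mp h.summable
      have := (Real.rpow_pos_of_pos hv ((a + b + 1) / 2)).ne'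
      exact mul_ne_zero (mul_ne_zero (mul_ne_zero (hA ha) (hA hb)) this) h0
  rw [← h.tsum_eq, tsum_mul_left, euler_hasSum _ _ (by norm_num) hz hsum]
  rw [show 3 / 2 - (1 - a) / 2 = a / 2 + 1 by ring, show 3 / 2 - (1 - b) / 2 = b / 2 + 1 by ring,
    show a / 2 + 1 - (1 - b) / 2 = (a + b + 1) / 2 by ring]
  ring

lemma case_boundary {ρ a b : ℝ} (ha : -1 < a) (hb : -1 < b) (hρ : ρ ^ 2 = 1) :
    corrExp ρ (fun g₁ g₂ => (Real.sign g₁ * |g₁| ^ a) * (Real.sign g₂ * |g₂| ^ b)) =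
      gaussNorm (a + 1) ^ (a + 1) * gaussNorm (b + 1) ^ (b + 1) *
        (ρ * ∑' k : ℕ, hgc ((1 - a) / 2) ((1 - b) / 2) (3 / 2) k * (ρ ^ 2) ^ k) := by
  have hL : corrExp ρ (fun g₁ g₂ => (Real.sign g₁ * |g₁| ^ a) * (Real.sign g₂ * |g₂| ^ b)) =
      ρ * (√(2 * π))⁻¹ * ∫ x : ℝ, |x| ^ (a + b) * Real.exp (-2⁻¹ * x ^ 2) := by
    unfold corrExp
    simp only [hρ, sub_self, Real.sqrt_zero, zero_mul, add_zero]
    rw [integral_const, probReal_univ, one_smul,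
      integral_gaussianReal_eq_integral_smul (one_ne_zero), ← integral_const_mul]
    have h0 : ∀ᵐ x : ℝ, x ≠ 0 := by
      simp [ae_iff]
    refine integral_congr_ae ?_
    filter_upwards [h0] with x hx
    have hx' : 0 < |x| := abs_pos.mpr hx
    have hs : Real.sign (ρ * x) * Real.sign x = ρ := by
      rcases (show ρ = 1 ∨ ρ = -1 from by simpa using hρ) with h | h <;> rcases lt_or_gt_of_ne hx with h2 | h2
      all_goals subst h
      · rw [one_mul, Real.sign_of_neg h2]; norm_num
      · rw [one_mul, Real.sign_of_pos h2]; norm_num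
      · rw [Real.sign_of_neg h2, Real.sign_of_pos (by linarith)]; norm_num
      · rw [Real.sign_of_pos h2, Real.sign_of_neg (by linarith)]; norm_num
    have habs : |ρ * x| = |x| := by
      have : |ρ| = 1 := by
        have := congrArg Real.sqrt hρ
        simpa [Real.sqrt_sq_eq_abs] using this
      rw [abs_mul, this, one_mul]
    rw [habs, Real.rpow_add hx', smul_eq_mul]
    simp only [gaussianPDFReal, NNReal.coe_one, mul_one, sub_zero]
    rw [show -x ^ 2 / 2 = -2⁻¹ * x ^ 2 by ring]
    linear_combination ((√(2 * π))⁻¹ * Real.exp (-2⁻¹ * x ^ 2) * |x| ^ a * |x| ^ b) * hs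
  rw [hL, hρ]
  simp only [one_pow, mul_one]
  rcases lt_or_ge (-1) (a + b) with hab | hab
  · rw [gauss_sum _ _ (by norm_num) (by linarith) (by linarith) (by linarith),
      integral_abs_gauss hab (by norm_num), gaussNorm_pow ha, gaussNorm_pow hb,
      show 3 / 2 - (1 - a) / 2 = a / 2 + 1 by ring, show 3 / 2 - (1 - b) / 2 = b / 2 + 1 by ring,
      show a / 2 + 1 - (1 - b) / 2 = (a + b + 1) / 2 by ring]
    have g1 := (Real.Gamma_pos_of_pos (show 0 < a / 2 + 1 by linarith)).ne'
    have g2 := (Real.Gamma_pos_of_pos (show 0 < b / 2 + 1 by linarith)).ne'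
    have g3 : Real.Gamma (3 / 2) = √π / 2 := by
      rw [show (3 / 2 : ℝ) = 1 / 2 + 1 by norm_num, Real.Gamma_add_one (by norm_num), Real.Gamma_one_half_eq]
      ring
    have p1 : (2⁻¹ : ℝ) ^ (-(a + b + 1) / 2) = 2 ^ ((a + b + 1) / 2) := by
      rw [neg_div, Real.inv_rpow (by norm_num), Real.rpow_neg (by norm_num), inv_inv]
    have p2 : (2:ℝ) ^ (a / 2 + 1) * 2 ^ (b / 2 + 1) = 2 ^ ((a + b + 1) / 2) * √2 * 2 := by
      rw [Real.sqrt_eq_rpow, ← Real.rpow_add two_pos, ← Real.rpow_add two_pos, ← Real.rpow_add_one two_ne_zero]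
      congr 1; ring
    rw [g3, p1, Real.sqrt_mul (by norm_num)]
    have s2 : √(2:ℝ) ≠ 0 := by positivity
    have sπ : √π ≠ 0 := by positivity
    calc _ = ρ * (√2 * √π)⁻¹ * (2 ^ ((a + b + 1) / 2) * Real.Gamma ((a + b + 1) / 2)) := by ring
      _ = (√2 * √π)⁻¹ * (√2 * √π)⁻¹ * (2 ^ ((a + b + 1) / 2) * √2 * 2) * ρ * (√π / 2) * Real.Gamma ((a + b + 1) / 2) := by
        field_simp
      _ = _ := by
        rw [← p2]
        generalize Real.Gamma (a / 2 + 1) = G1 at g1 ⊢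
        generalize Real.Gamma (b / 2 + 1) = G2 at g2 ⊢
        field_simp
  · rw [integral_undef (not_int_abs hab), tsum_eq_zero_of_not_summable
      (hgc_not_summable _ _ (by norm_num) (by linarith) (by linarith) (by linarith))]
    simp


theorem hypergeometric_representation (a b : ℝ) (ha : -1 < a) (hb : -1 < b)
    (ρ : ℝ) (hρ : ρ ∈ Set.Icc (-1 : ℝ) 1) :
    corrExp ρ (fun g₁ g₂ => (Real.sign g₁ * |g₁| ^ a) * (Real.sign g₂ * |g₂| ^ b)) =
      gaussNorm (a + 1) ^ (a + 1) * gaussNorm (b + 1) ^ (b + 1) *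
        ∑' k : ℕ,
          (risingFac ((1 - a) / 2) k * risingFac ((1 - b) / 2) k /
              (risingFac (3 / 2) k * (Nat.factorial k))) * ρ ^ (2 * k + 1) := by
  have hrhs : (∑' k : ℕ, (risingFac ((1 - a) / 2) k * risingFac ((1 - b) / 2) k /
      (risingFac (3 / 2) k * (Nat.factorial k))) * ρ ^ (2 * k + 1)) =
      ρ * ∑' k : ℕ, hgc ((1 - a) / 2) ((1 - b) / 2) (3 / 2) k * (ρ ^ 2) ^ k := by
    rw [← tsum_mul_left]
    congr 1
    ext k
    rw [hgc, ← pow_mul, pow_succ]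
    ring
  rw [hrhs]
  have h1 : |ρ| ≤ 1 := abs_le.mpr ⟨hρ.1, hρ.2⟩
  rcases lt_or_eq_of_le h1 with h | h
  · exact case_interior ha hb h
  · refine case_boundary ha hb ?_
    rw [← sq_abs, h, one_pow]
end
end

section
/- Let c ≥ 0 and let f^{(c)}(τ) = sgn(τ)·|τ|^c with Hermite coefficients f̂^{(c)}_k. Then for every λ ∈ ℝ: Σ_{k≥0} (λ^{2k+1}/√((2k+1)!)) · f̂^{(c)}_{2k+1} = (1/√(2π)) · ∫₀^∞ τ^c · ( e^{−(τ−λ)²/2} − e^{−(τ+λ)²/2} ) dτ. -/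
noncomputable section

open MeasureTheory ProbabilityTheory Real Set

/-- The normalized probabilists' Hermite polynomial
`H_k(τ) = (1/√(k!))·(−1)^k·e^{τ²/2}·(d/dτ)^k e^{−τ²/2}`. -/
def hermiteFn (k : ℕ) (τ : ℝ) : ℝ :=
  (1 / Real.sqrt (Nat.factorial k)) * (-1) ^ k * Real.exp (τ ^ 2 / 2) *
    iteratedDeriv k (fun x => Real.exp (-x ^ 2 / 2)) τ

/-- The `k`-th Hermite coefficient `f̂_k = ∫ f(τ) H_k(τ) dγ(τ)`. -/
def hermiteCoeff (f : ℝ → ℝ) (k : ℕ) : ℝ :=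
  ∫ τ, f τ * hermiteFn k τ ∂(gaussianReal 0 1)

/-- `f^{(c)}(τ) = sgn(τ)·|τ|^c`. -/
def signPow (c : ℝ) (τ : ℝ) : ℝ := Real.sign τ * |τ| ^ c

def gR : ℝ → ℝ := fun x => Real.exp (-x ^ 2 / 2)
def gC : ℂ → ℂ := fun x => Complex.exp (-x ^ 2 / 2)

lemma gC_contDiff : ContDiff ℂ ⊤ gC := by unfold gC; fun_prop

lemma gR_contDiff : ContDiff ℝ ⊤ gR := by unfold gR; fun_prop

lemma gR_cont (n : ℕ) : Continuous (iteratedDeriv n gR) :=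
  gR_contDiff.continuous_iteratedDeriv n le_top

lemma gR_re (n : ℕ) : ∀ x : ℝ, iteratedDeriv n gR x = (iteratedDeriv n gC x).re := by
  induction n with
  | zero =>
    intro x
    have : gC x = ((gR x : ℝ) : ℂ) := by simp [gC, gR]
    simp [this]
  | succ n ih =>
    intro x
    rw [iteratedDeriv_succ, iteratedDeriv_succ, show iteratedDeriv n gR = _ from funext ih]
    have h : DifferentiableAt ℂ (iteratedDeriv n gC) x :=
      (gC_contDiff.differentiable_iteratedDeriv n (by exact_mod_cast WithTop.coe_lt_top _)) x
    exact (h.hasDerivAt.real_of_complex).deriv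

lemma gR_bound (n : ℕ) (x R : ℝ) (hR : 0 < R) :
    |iteratedDeriv n gR x| ≤ n.factorial * Real.exp (R ^ 2 / 2 - x ^ 2 / 4) / R ^ n := by
  rw [gR_re]
  refine (Complex.abs_re_le_norm _).trans ?_
  refine Complex.norm_iteratedDeriv_le_of_forall_mem_sphere_norm_le n hR
    (gC_contDiff.differentiable (by simp)).diffContOnCl ?_
  intro z hz
  rw [gC, Complex.norm_exp, Real.exp_le_exp]
  rw [mem_sphere_iff_norm] at hz
  have h2 : (z.re - x) ^ 2 + z.im ^ 2 = R ^ 2 := by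
    rw [← hz, Complex.sq_norm, Complex.normSq_apply]; simp; ring
  have h3 : (-z ^ 2 / 2).re = -(z.re ^ 2 - z.im ^ 2) / 2 := by
    have : (-z ^ 2 / 2) = ((-1/2 : ℝ) : ℂ) * (z * z) := by push_cast; ring
    rw [this, Complex.re_ofReal_mul, Complex.mul_re]; ring
  rw [h3]
  nlinarith [sq_nonneg (2 * z.re - x)]

lemma gR_taylor (x l : ℝ) :
    HasSum (fun n : ℕ => l ^ n / n.factorial * iteratedDeriv n gR x) (gR (x + l)) := by
  have h := Complex.hasSum_taylorSeries_of_entire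
    (gC_contDiff.differentiable (by simp)) (x : ℂ) ((x + l : ℝ) : ℂ)
  have h' := Complex.hasSum_re h
  have e : (gC ((x + l : ℝ) : ℂ)).re = gR (x + l) := by simpa using (gR_re 0 (x + l)).symm
  rw [e] at h'
  convert h' using 2 with n
  rw [gR_re]
  have : ((n.factorial : ℂ)⁻¹ • (((x + l : ℝ) : ℂ) - x) ^ n • iteratedDeriv n gC x)
      = ((l ^ n / n.factorial : ℝ) : ℂ) * iteratedDeriv n gC x := by
    simp only [smul_eq_mul]; push_cast; ring
  rw [this, Complex.re_ofReal_mul]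

lemma gR_odd_taylor (x l : ℝ) :
    HasSum (fun k : ℕ => -2 * (l ^ (2 * k + 1) / (2 * k + 1).factorial *
      iteratedDeriv (2 * k + 1) gR x)) (gR (x - l) - gR (x + l)) := by
  have h := (gR_taylor x (-l)).sub (gR_taylor x l)
  rw [← sub_eq_add_neg] at h
  have hi : Function.Injective (fun k : ℕ => 2 * k + 1) := fun a b h => by simpa using h
  rw [← hi.hasSum_iff] at h
  · refine (congrArg (fun u => HasSum u (gR (x - l) - gR (x + l))) (funext fun k => ?_)).mpr h
    have : Odd (2 * k + 1) := ⟨k, rfl⟩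
    simp only [Function.comp, this.neg_pow]; ring
  · intro n hn
    have : Even n := by
      by_contra hne
      obtain ⟨k, hk⟩ := Nat.not_even_iff_odd.1 hne
      exact hn ⟨k, hk.symm⟩
    simp [this.neg_pow]

lemma gR_odd (k : ℕ) (x : ℝ) :
    iteratedDeriv (2 * k + 1) gR (-x) = - iteratedDeriv (2 * k + 1) gR x := by
  have h := iteratedDeriv_comp_neg (2 * k + 1) gR x
  have e : (fun x => gR (-x)) = gR := by funext x; simp [gR]
  rw [e, Odd.neg_one_pow ⟨k, rfl⟩] at h
  simp at h; linarith

lemma coeff_eq (c : ℝ) (k : ℕ) :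
    hermiteCoeff (signPow c) (2 * k + 1) =
      -2 * (1 / Real.sqrt (2 * Real.pi)) * (1 / Real.sqrt (Nat.factorial (2 * k + 1))) *
      ∫ τ in Ioi (0 : ℝ), τ ^ c * iteratedDeriv (2 * k + 1) gR τ := by
  unfold hermiteCoeff
  rw [integral_gaussianReal_eq_integral_smul one_ne_zero]
  have key : ∀ τ : ℝ, gaussianPDFReal 0 1 τ • (signPow c τ * hermiteFn (2 * k + 1) τ) =
      -(1 / Real.sqrt (2 * Real.pi)) * (1 / Real.sqrt (Nat.factorial (2 * k + 1))) *
        (fun y => y ^ c * iteratedDeriv (2 * k + 1) gR y) |τ| := by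
    intro τ
    have e : Real.exp (-τ ^ 2 / 2) * Real.exp (τ ^ 2 / 2) = 1 := by
      rw [← Real.exp_add]; ring_nf; simp
    have s : Real.sign τ * iteratedDeriv (2 * k + 1) gR τ = iteratedDeriv (2 * k + 1) gR |τ| := by
      rcases lt_trichotomy τ 0 with h | h | h
      · rw [Real.sign_of_neg h, abs_of_neg h, gR_odd]; ring
      · have := gR_odd k 0
        simp only [neg_zero] at this
        subst h; simp; linarith
      · rw [Real.sign_of_pos h, abs_of_pos h]; ring
    simp only [← s]
    rw [hermiteFn, signPow, gaussianPDFReal, Odd.neg_one_pow ⟨k, rfl⟩]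
    change _ • (_ * (_ * iteratedDeriv (2 * k + 1) gR τ)) = _
    simp only [smul_eq_mul, sub_zero, NNReal.coe_one, mul_one]
    linear_combination (-(1 / Real.sqrt (2 * Real.pi)) * (1 / Real.sqrt (Nat.factorial (2 * k + 1)))
      * Real.sign τ * |τ| ^ c * iteratedDeriv (2 * k + 1) gR τ) * e
  simp_rw [key]
  rw [integral_const_mul,
    integral_comp_abs (f := fun y => y ^ c * iteratedDeriv (2 * k + 1) gR y)]
  ring

theorem hermite_generating_function_integral_rep (c : ℝ) (hc : 0 ≤ c) (lam : ℝ) :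
    (∑' k : ℕ,
        lam ^ (2 * k + 1) / Real.sqrt (Nat.factorial (2 * k + 1)) *
          hermiteCoeff (signPow c) (2 * k + 1)) =
      (1 / Real.sqrt (2 * Real.pi)) *
        ∫ τ in Set.Ioi (0 : ℝ),
          τ ^ c * (Real.exp (-(τ - lam) ^ 2 / 2) - Real.exp (-(τ + lam) ^ 2 / 2)) := by
  have hsum : ∀ τ : ℝ, HasSum (fun k : ℕ => τ ^ c * (-2 * (lam ^ (2 * k + 1) /
      (2 * k + 1).factorial * iteratedDeriv (2 * k + 1) gR τ)))
      (τ ^ c * (Real.exp (-(τ - lam) ^ 2 / 2) - Real.exp (-(τ + lam) ^ 2 / 2))) :=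
    fun τ => (gR_odd_taylor τ lam).mul_left _
  set F : ℕ → ℝ → ℝ := fun k τ => τ ^ c * (-2 * (lam ^ (2 * k + 1) /
      (2 * k + 1).factorial * iteratedDeriv (2 * k + 1) gR τ)) with hF
  set R : ℝ := |lam| + 1 with hRdef
  have hR : 0 < R := by positivity
  set q : ℝ := |lam| / R with hq
  have hq0 : 0 ≤ q := by positivity
  have hq1 : q < 1 := by rw [hq, div_lt_one hR]; linarith
  have hbint : IntegrableOn (fun τ : ℝ => τ ^ c * Real.exp (-(1/4) * τ ^ 2)) (Ioi 0) :=
    integrableOn_rpow_mul_exp_neg_mul_sq (by norm_num) (by linarith)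
  have hFb : ∀ k, ∀ τ ∈ Ioi (0 : ℝ), ‖F k τ‖ ≤ (2 * Real.exp (R ^ 2 / 2) * q ^ (2 * k + 1)) *
      (τ ^ c * Real.exp (-(1/4) * τ ^ 2)) := by
    intro k τ hτ
    have hp : 0 ≤ τ ^ c := Real.rpow_nonneg (le_of_lt hτ) _
    have hf : (0 : ℝ) < (2 * k + 1).factorial := by positivity
    simp only [hF, Real.norm_eq_abs, abs_mul, abs_div, abs_pow, abs_of_nonneg hp, abs_neg,
      abs_of_pos hf, abs_two]
    calc τ ^ c * (2 * (|lam| ^ (2 * k + 1) / (2 * k + 1).factorial *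
          |iteratedDeriv (2 * k + 1) gR τ|))
        ≤ τ ^ c * (2 * (|lam| ^ (2 * k + 1) / (2 * k + 1).factorial *
          ((2 * k + 1).factorial * Real.exp (R ^ 2 / 2 - τ ^ 2 / 4) / R ^ (2 * k + 1)))) := by
          gcongr
          exact gR_bound _ _ _ hR
      _ = _ := by
          rw [show R ^ 2 / 2 - τ ^ 2 / 4 = R ^ 2 / 2 + -(1/4) * τ ^ 2 by ring, Real.exp_add, hq,
            div_pow]
          field_simp
  have hFint : ∀ k, Integrable (F k) (volume.restrict (Ioi 0)) := by
    intro k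
    refine Integrable.mono' (hbint.const_mul (2 * Real.exp (R ^ 2 / 2) * q ^ (2 * k + 1))) ?_ ?_
    · have := (gR_cont (2 * k + 1)).measurable
      have h : Measurable (F k) := by
        simp only [hF]
        fun_prop
      exact h.aestronglyMeasurable
    · exact (ae_restrict_mem measurableSet_Ioi).mono (hFb k)
  have hS : Summable fun k => ∫ τ in Ioi (0 : ℝ), ‖F k τ‖ := by
    refine Summable.of_nonneg_of_le (fun k => integral_nonneg fun _ => norm_nonneg _)
      (fun k => ?_) (f := fun k => (2 * Real.exp (R ^ 2 / 2) * q ^ (2 * k + 1)) *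
        ∫ τ in Ioi (0 : ℝ), (τ ^ c * Real.exp (-(1/4) * τ ^ 2))) ?_
    · rw [← integral_const_mul]
      exact setIntegral_mono_on (hFint k).norm (hbint.const_mul _) measurableSet_Ioi (hFb k)
    · refine Summable.mul_right _ (Summable.mul_left _ ?_)
      exact (summable_geometric_of_lt_one hq0 hq1).comp_injective
        (i := fun k : ℕ => 2 * k + 1) (fun a b h => by simpa using h)
  have main := hasSum_integral_of_summable_integral_norm hFint hS
  rw [show (fun τ => ∑' k, F k τ) = _ from funext fun τ => (hsum τ).tsum_eq] at main
  rw [← (main.mul_left (1 / Real.sqrt (2 * Real.pi))).tsum_eq]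
  congr 1
  funext k
  rw [coeff_eq]
  have e : (∫ τ in Ioi (0 : ℝ), F k τ) = -2 * (lam ^ (2 * k + 1) / (2 * k + 1).factorial) *
      ∫ τ in Ioi (0 : ℝ), τ ^ c * iteratedDeriv (2 * k + 1) gR τ := by
    rw [← integral_const_mul]
    congr 1
    funext τ
    simp only [hF]; ring
  rw [e]
  have hs : (1 / Real.sqrt (Nat.factorial (2 * k + 1))) * (1 / Real.sqrt (Nat.factorial (2 * k + 1)))
      = 1 / ((2 * k + 1).factorial : ℝ) := by
    rw [one_div_mul_one_div_rev, Real.mul_self_sqrt (by positivity)]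
  linear_combination (-2 * lam ^ (2 * k + 1) * (1 / Real.sqrt (2 * Real.pi)) *
    ∫ τ in Ioi (0 : ℝ), τ ^ c * iteratedDeriv (2 * k + 1) gR τ) * hs
end
end

section
/- Let 1 ≤ q ≤ 2 ≤ p < ∞, set p* = p/(p−1), a = p* − 1, b = q − 1. Let W₁ ∈ ℝ^{m×ℓ} with rows w₁¹,…,w₁^m satisfying Σᵢ ‖w₁ⁱ‖₂^{q} ≤ 1, and W₂ ∈ ℝ^{n×ℓ} with rows w₂¹,…,w₂ⁿ satisfying Σⱼ ‖w₂ʲ‖₂^{p*} ≤ 1. Then for g a standard Gaussian vector on ℝ^ℓ: E_g[ ‖W₁g‖_q^{b} · ‖W₂g‖_{p*}^{a} ] ≤ γ_q^{b} · γ_{p*}^{a}. -/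
noncomputable section

open MeasureTheory ProbabilityTheory Real Set

/-- The `ℓ_r` norm of a vector in `ℝ^d`. -/
def lpnorm (r : ℝ) {d : ℕ} (x : Fin d → ℝ) : ℝ :=
  (∑ i, |x i| ^ r) ^ (1 / r)

/-- The standard Gaussian measure on `ℝ^ℓ` (i.i.d. standard Gaussian coordinates). -/
def gaussVec (ℓ : ℕ) : Measure (Fin ℓ → ℝ) :=
  Measure.pi fun _ => gaussianReal 0 1


lemma lpnorm_nonneg' (r : ℝ) {d : ℕ} (x : Fin d → ℝ) : 0 ≤ lpnorm r x := by
  unfold lpnorm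
  exact Real.rpow_nonneg (Finset.sum_nonneg fun i _ => Real.rpow_nonneg (abs_nonneg _) _) _

lemma lpnorm_rpow {r : ℝ} (hr : r ≠ 0) (s : ℝ) {d : ℕ} (x : Fin d → ℝ) :
    lpnorm r x ^ s = (∑ i, |x i| ^ r) ^ (s / r) := by
  unfold lpnorm
  rw [← Real.rpow_mul (Finset.sum_nonneg fun i _ => Real.rpow_nonneg (abs_nonneg _) _)]
  congr 1
  ring

lemma lpnorm_two_sq {d : ℕ} (x : Fin d → ℝ) : lpnorm 2 x ^ 2 = ∑ i, x i ^ 2 := by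
  have h := lpnorm_rpow (two_ne_zero) 2 x
  rw [div_self two_ne_zero, Real.rpow_one] at h
  have h2 : lpnorm 2 x ^ (2:ℝ) = lpnorm 2 x ^ 2 := Real.rpow_natCast _ 2
  rw [← h2, h]
  refine Finset.sum_congr rfl fun i _ => ?_
  have : |x i| ^ (2:ℝ) = |x i| ^ 2 := Real.rpow_natCast _ 2
  rw [this, sq_abs]

instance (ℓ : ℕ) : IsProbabilityMeasure (gaussVec ℓ) := by
  unfold gaussVec; infer_instance

lemma gaussVec_map {ℓ : ℕ} (w : Fin ℓ → ℝ) :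
    (gaussVec ℓ).map (fun g => w ⬝ᵥ g) = (gaussianReal 0 1).map (fun x => lpnorm 2 w * x) := by
  have hm : Measurable (fun g : Fin ℓ → ℝ => w ⬝ᵥ g) := by
    unfold dotProduct; fun_prop
  have : IsProbabilityMeasure ((gaussVec ℓ).map (fun g => w ⬝ᵥ g)) :=
    Measure.isProbabilityMeasure_map hm.aemeasurable
  have : IsProbabilityMeasure ((gaussianReal 0 1).map (fun x => lpnorm 2 w * x)) :=
    Measure.isProbabilityMeasure_map (by fun_prop)
  apply Measure.ext_of_charFun
  ext t
  have h : charFun ((gaussVec ℓ).map (fun g => ∑ i, w i * g i)) t =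
      (∏ i, charFun ((gaussVec ℓ).map (fun g => w i * g i))) t := by
    rw [iIndepFun.charFun_map_fun_sum_eq_prod (X := fun i (g : Fin ℓ → ℝ) => w i * g i)]
    · intro i; exact Measurable.aemeasurable (by fun_prop)
    · exact iIndepFun_pi (X := fun i x => w i * x) (fun _ ↦ by fun_prop)
  have h2 : ∀ i, (gaussVec ℓ).map (fun g => w i * g i) =
      (gaussianReal 0 1).map (fun x => w i * x) := by
    intro i
    have := (measurePreserving_eval (fun _ : Fin ℓ => gaussianReal 0 1) i).map_eq
    conv_rhs => rw [← this]
    rw [Measure.map_map (by fun_prop) (by fun_prop)]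
    rfl
  change charFun ((gaussVec ℓ).map (fun g => ∑ i, w i * g i)) t = _
  rw [h, Finset.prod_apply]
  simp_rw [h2, gaussianReal_map_const_mul, charFun_gaussianReal]
  rw [← Complex.exp_sum]
  congr 1
  simp
  rw [← Finset.sum_div, ← Finset.sum_mul]
  have := lpnorm_two_sq w
  rw [← Complex.ofReal_pow (lpnorm 2 w), this]
  push_cast
  rfl

def gM (r : ℝ) : ℝ := ∫ x, |x| ^ r ∂(gaussianReal 0 1)

lemma gM_int {r : ℝ} (hr : 0 < r) : Integrable (fun x : ℝ => |x| ^ r) (gaussianReal 0 1) := by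
  have := (memLp_id_gaussianReal' (μ := 0) (v := 1) (ENNReal.ofReal r) (by simp)).integrable_norm_rpow
    (by simpa using hr) (by simp)
  simpa [ENNReal.toReal_ofReal hr.le] using this

lemma gM_pos {r : ℝ} (hr : 0 < r) : 0 < gM r := by
  unfold gM
  rw [integral_pos_iff_support_of_nonneg (fun x => Real.rpow_nonneg (abs_nonneg _) _) (gM_int hr)]
  have : Function.support (fun x : ℝ => |x| ^ r) = {0}ᶜ := by
    ext x
    simp [Real.rpow_eq_zero_iff_of_nonneg, hr.ne']
  rw [this]
  have := nullSingletonClass_gaussianReal (μ := 0) (v := 1) one_ne_zero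
  rw [prob_compl_eq_one_sub (by simp)]
  simp

lemma gaussNorm_rpow {r : ℝ} (hr : 0 < r) (s : ℝ) : gaussNorm r ^ s = gM r ^ (s / r) := by
  have : (∫ x : ℝ, |x| ^ r * ((Real.sqrt (2 * Real.pi))⁻¹ * Real.exp (-x ^ 2 / 2))) = gM r := by
    unfold gM
    rw [integral_gaussianReal_eq_integral_smul (by simp)]
    refine integral_congr_ae (ae_of_all _ fun x => ?_)
    simp [gaussianPDFReal]
    ring
  unfold gaussNorm
  rw [this, ← Real.rpow_mul (gM_pos hr).le]
  congr 1
  ring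

lemma dot_int {r : ℝ} (hr : 0 < r) {ℓ : ℕ} (w : Fin ℓ → ℝ) :
    Integrable (fun g => |w ⬝ᵥ g| ^ r) (gaussVec ℓ) ∧
    ∫ g, |w ⬝ᵥ g| ^ r ∂(gaussVec ℓ) = lpnorm 2 w ^ r * gM r := by
  have hm : Measurable (fun g : Fin ℓ → ℝ => w ⬝ᵥ g) := by
    unfold dotProduct; fun_prop
  have hf : Measurable (fun x : ℝ => |x| ^ r) := by fun_prop
  have hE : (fun x => |lpnorm 2 w * x| ^ r) = fun x => lpnorm 2 w ^ r * |x| ^ r := by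
    ext x
    rw [abs_mul, abs_of_nonneg (lpnorm_nonneg' _ _), Real.mul_rpow (lpnorm_nonneg' _ _) (abs_nonneg _)]
  constructor
  · have : Integrable (fun x : ℝ => |x| ^ r) ((gaussVec ℓ).map (fun g => w ⬝ᵥ g)) := by
      rw [gaussVec_map, integrable_map_measure hf.aestronglyMeasurable (by fun_prop)]
      change Integrable (fun x => |lpnorm 2 w * x| ^ r) _
      rw [hE]
      exact (gM_int hr).const_mul _
    exact this.comp_measurable hm
  · rw [← integral_map (φ := fun g => w ⬝ᵥ g) (f := fun x : ℝ => |x| ^ r) hm.aemeasurable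
      hf.aestronglyMeasurable, gaussVec_map, integral_map (by fun_prop) hf.aestronglyMeasurable,
      hE, integral_const_mul, gM]

lemma mat_int {r : ℝ} (hr : 0 < r) {k ℓ : ℕ} (W : Matrix (Fin k) (Fin ℓ) ℝ)
    (hW : ∑ i, lpnorm 2 (W i) ^ r ≤ 1) :
    Integrable (fun g => ∑ i, |W.mulVec g i| ^ r) (gaussVec ℓ) ∧
    ∫ g, ∑ i, |W.mulVec g i| ^ r ∂(gaussVec ℓ) ≤ gM r := by
  have hi : ∀ i, Integrable (fun g => |W.mulVec g i| ^ r) (gaussVec ℓ) :=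
    fun i => (dot_int hr (W i)).1
  refine ⟨integrable_finsetSum _ fun i _ => hi i, ?_⟩
  rw [integral_finsetSum _ fun i _ => hi i]
  have : ∀ i, ∫ g, |W.mulVec g i| ^ r ∂(gaussVec ℓ) = lpnorm 2 (W i) ^ r * gM r :=
    fun i => (dot_int hr (W i)).2
  simp_rw [this]
  rw [← Finset.sum_mul]
  exact mul_le_of_le_one_left (gM_pos hr).le hW

theorem denominator_bound (p q : ℝ) (hq1 : 1 ≤ q) (hq2 : q ≤ 2) (hp : 2 ≤ p)
    (m n ℓ : ℕ) (W₁ : Matrix (Fin m) (Fin ℓ) ℝ) (W₂ : Matrix (Fin n) (Fin ℓ) ℝ)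
    (hW₁ : ∑ i, lpnorm 2 (W₁ i) ^ q ≤ 1)
    (hW₂ : ∑ j, lpnorm 2 (W₂ j) ^ (p / (p - 1)) ≤ 1) :
    (∫ g : Fin ℓ → ℝ,
        lpnorm q (W₁.mulVec g) ^ (q - 1) *
          lpnorm (p / (p - 1)) (W₂.mulVec g) ^ (p / (p - 1) - 1) ∂(gaussVec ℓ)) ≤
      gaussNorm q ^ (q - 1) * gaussNorm (p / (p - 1)) ^ (p / (p - 1) - 1) := by
  have hs1 : 1 ≤ p / (p - 1) := by rw [le_div_iff₀ (by linarith)]; linarith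
  have hs2 : p / (p - 1) ≤ 2 := by rw [div_le_iff₀ (by linarith)]; linarith
  generalize p / (p - 1) = s at *
  have hq0 : 0 < q := by linarith
  have hs0 : 0 < s := by linarith
  simp_rw [lpnorm_rpow hq0.ne', lpnorm_rpow hs0.ne', gaussNorm_rpow hq0, gaussNorm_rpow hs0]
  have half : ∀ r : ℝ, 1 ≤ r → r ≤ 2 → 0 ≤ (r - 1) / r ∧ (r - 1) / r ≤ 1 / 2 := by
    intro r h1 h2
    refine ⟨div_nonneg (by linarith) (by linarith), ?_⟩
    rw [div_le_iff₀ (by linarith)]; linarith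
  obtain ⟨hα0, hα1⟩ := half q hq1 hq2
  obtain ⟨hβ0, hβ1⟩ := half s hs1 hs2
  generalize (q - 1) / q = α at *
  generalize (s - 1) / s = β at *
  obtain ⟨iX, eX⟩ := mat_int hq0 W₁ hW₁
  obtain ⟨iY, eY⟩ := mat_int hs0 W₂ hW₂
  have hA := gM_pos hq0
  have hB := gM_pos hs0
  have nX : ∀ g, 0 ≤ ∑ i, |W₁.mulVec g i| ^ q :=
    fun g => Finset.sum_nonneg fun i _ => Real.rpow_nonneg (abs_nonneg _) _
  have nY : ∀ g, 0 ≤ ∑ i, |W₂.mulVec g i| ^ s :=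
    fun g => Finset.sum_nonneg fun i _ => Real.rpow_nonneg (abs_nonneg _) _
  generalize hX : (fun g => ∑ i, |W₁.mulVec g i| ^ q) = X at *
  generalize hY : (fun g => ∑ i, |W₂.mulVec g i| ^ s) = Y at *
  replace hX : ∀ g, ∑ i, |W₁.mulVec g i| ^ q = X g := fun g => congrFun hX g
  replace hY : ∀ g, ∑ i, |W₂.mulVec g i| ^ s = Y g := fun g => congrFun hY g
  simp_rw [hX] at *
  simp_rw [hY] at *
  generalize gM q = A at *
  generalize gM s = B at *
  have hAB : 0 < A ^ α * B ^ β := by positivity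
  have key : ∀ g, X g ^ α * Y g ^ β ≤
      (A ^ α * B ^ β) * (α * (X g / A) + β * (Y g / B) + (1 - α - β)) := by
    intro g
    have h := Real.geom_mean_le_arith_mean3_weighted (p₁ := X g / A) (p₂ := Y g / B) (p₃ := 1)
      hα0 hβ0 (by linarith : 0 ≤ 1 - α - β) (div_nonneg (nX g) hA.le) (div_nonneg (nY g) hB.le)
      zero_le_one (by ring)
    rw [Real.one_rpow, mul_one, mul_one, Real.div_rpow (nX g) hA.le, Real.div_rpow (nY g) hB.le,
      div_mul_div_comm, div_le_iff₀ hAB] at h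
    linarith
  have i1 : Integrable (fun g => α * (X g / A)) (gaussVec ℓ) := (iX.div_const A).const_mul α
  have i2 : Integrable (fun g => β * (Y g / B)) (gaussVec ℓ) := (iY.div_const B).const_mul β
  have i3 : Integrable (fun g => α * (X g / A) + β * (Y g / B)) (gaussVec ℓ) := i1.add i2
  have i4 : Integrable (fun g => α * (X g / A) + β * (Y g / B) + (1 - α - β)) (gaussVec ℓ) :=
    i3.add (integrable_const _)
  calc _ ≤ ∫ g, (A ^ α * B ^ β) * (α * (X g / A) + β * (Y g / B) + (1 - α - β)) ∂(gaussVec ℓ) :=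
        integral_mono_of_nonneg
          (ae_of_all _ fun g => mul_nonneg (Real.rpow_nonneg (nX g) _) (Real.rpow_nonneg (nY g) _))
          (i4.const_mul _) (ae_of_all _ key)
    _ ≤ A ^ α * B ^ β := by
        rw [integral_const_mul, integral_add i3 (integrable_const _), integral_add i1 i2,
          integral_const_mul, integral_const_mul, integral_div, integral_div]
        apply mul_le_of_le_one_right hAB.le
        have h1 : α * ((∫ g, X g ∂(gaussVec ℓ)) / A) ≤ α * 1 :=
          mul_le_mul_of_nonneg_left ((div_le_one hA).2 eX) hα0
        have h2 : β * ((∫ g, Y g ∂(gaussVec ℓ)) / B) ≤ β * 1 :=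
          mul_le_mul_of_nonneg_left ((div_le_one hB).2 eY) hβ0
        simp
        linarith
end
end
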